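/- Let X be a non-separable complex Banach space with the property that every bounded linear operator on X has the form w·I + S for some w ∈ ℂ, where S is strictly singular and has separable range. Then for every bounded linear operator T on X and every non-zero vector x ∈ X, the J-set J_T(x) has empty interior. -/

import Mathlib

open Filter Topology

/-- The J-set of `x` under the operator `T`. -/
def JSet {𝕜 X : Type*} [NontriviallyNormedField 𝕜] [NormedAddCommGroup X] [NormedSpace 𝕜 X]
    (T : X →L[𝕜] X) (x : X) : Set X :=
  {y | ∃ k : ℕ → ℕ, StrictMono k ∧ ∃ u : ℕ → X,
    Tendsto u atTop (𝓝 x) ∧ Tendsto (fun n => (T ^ k n) (u n)) atTop (𝓝 y)}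

/-- A bounded operator is strictly singular if it is bounded below by no positive constant
on any infinite-dimensional subspace. -/
def StrictlySingular {𝕜 X : Type*} [NontriviallyNormedField 𝕜] [NormedAddCommGroup X]
    [NormedSpace 𝕜 X] (S : X →L[𝕜] X) : Prop :=
  ∀ M : Submodule 𝕜 X, ¬ FiniteDimensional 𝕜 M →
    ¬ ∃ c : ℝ, 0 < c ∧ ∀ x ∈ M, c * ‖x‖ ≤ ‖S x‖


section helpers
variable {X : Type*} [NormedAddCommGroup X] [NormedSpace ℂ X]

/-- An eigenfunctional with eigenvalue in the closed disc forces empty interior. -/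
lemma jset_empty_of_eigenfunctional (T : X →L[ℂ] X) (x : X) (f : X →L[ℂ] ℂ) (hf : f ≠ 0)
    (l : ℂ) (hl : ‖l‖ ≤ 1) (hfT : ∀ v, f (T v) = l * f v) : interior (JSet T x) = ∅ := by
  have hpow : ∀ (k : ℕ) v, f ((T ^ k) v) = l ^ k * f v := by
    intro k
    induction k with
    | zero => intro v; simp
    | succ k ih => intro v; rw [pow_succ', mul_apply_eq_comp, hfT, ih]; ring
  have key : ∃ r : ℝ, ∀ y ∈ JSet T x, f y ∈ Metric.sphere (0 : ℂ) r := by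
    rcases hl.lt_or_eq with hl | hl
    · refine ⟨0, ?_⟩
      rintro y ⟨k, hk, u, hu, hT⟩
      have h1 := (f.continuous.tendsto y).comp hT
      have h2 : Tendsto (fun n => l ^ k n * f (u n)) atTop (𝓝 (0 * f x)) :=
        ((tendsto_pow_atTop_nhds_zero_of_norm_lt_one hl).comp hk.tendsto_atTop).mul
          ((f.continuous.tendsto x).comp hu)
      have h3 : f y = 0 * f x := by
        refine tendsto_nhds_unique h1 (h2.congr fun n => ?_)
        exact (hpow _ _).symm
      simp [h3]
    · refine ⟨‖f x‖, ?_⟩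
      rintro y ⟨k, hk, u, hu, hT⟩
      have h1 := ((f.continuous.tendsto y).comp hT).norm
      have h2 := ((f.continuous.tendsto x).comp hu).norm
      have h3 : ‖f y‖ = ‖f x‖ := by
        refine tendsto_nhds_unique h1 (h2.congr fun n => ?_)
        simp only [Function.comp_apply, hpow, norm_mul, norm_pow, hl, one_pow, one_mul]
      simp [h3]
  obtain ⟨r, hr⟩ := key
  have hsurj : Function.Surjective f := by
    have : (f : X →ₗ[ℂ] ℂ) ≠ 0 := fun h => hf (by ext v; exact LinearMap.congr_fun h v)
    exact LinearMap.surjective this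
  have hopen : IsOpenMap f := by
    obtain ⟨v, hv⟩ := hsurj 1
    exact f.isOpenMap_of_ne_zero hf
  by_contra hne
  obtain ⟨y, hy⟩ := Set.nonempty_iff_ne_empty.2 hne
  have h1 : f '' interior (JSet T x) ⊆ interior (Metric.sphere (0 : ℂ) r) := by
    refine interior_maximal ?_ (hopen _ isOpen_interior)
    rintro _ ⟨z, hz, rfl⟩
    exact hr z (interior_subset hz)
  rw [interior_sphere'] at h1
  exact h1 ⟨y, hy, rfl⟩

lemma exists_functional_vanishing (Y : Submodule ℂ X) (hY : IsClosed (Y : Set X)) (hne : Y ≠ ⊤) :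
    ∃ f : X →L[ℂ] ℂ, f ≠ 0 ∧ ∀ y ∈ Y, f y = 0 := by
  obtain ⟨x, hx⟩ : ∃ x, x ∉ Y := by
    by_contra! h
    exact hne (by ext; simp [h])
  have : IsClosed (Y : Set X) := hY
  have hx' : (Y.mkQ x : X ⧸ Y) ≠ 0 := by simpa using hx
  obtain ⟨g, -, hg⟩ := exists_dual_vector ℂ (Y.mkQ x) (norm_ne_zero_iff.2 hx')
  refine ⟨g.comp Y.mkQL, ?_, ?_⟩
  · intro h
    have := DFunLike.congr_fun h x
    simp only [ContinuousLinearMap.comp_apply] at this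
    apply norm_ne_zero_iff.2 hx'
    have h2 : g (Y.mkQ x) = 0 := this
    rw [hg] at h2
    exact Complex.ofReal_eq_zero.1 h2
  · intro y hy
    have : Y.mkQL y = 0 := by simpa using hy
    simp [this]

lemma jset_empty_of_expanding [CompleteSpace X] [Nontrivial X] (T : X →L[ℂ] X) (x : X) (hx : x ≠ 0)
    (h : ∀ l : ℂ, ‖l‖ ≤ 1 → l ∉ spectrum ℂ T) : JSet T x = ∅ := by
  have h0 : IsUnit T := by
    have := h 0 (by simp)
    rwa [spectrum.zero_mem_iff, not_not] at this
  obtain ⟨a, rfl⟩ := h0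
  have hr : spectralRadius ℂ ((a⁻¹ : (X →L[ℂ] X)ˣ) : X →L[ℂ] X) < (1 : NNReal) := by
    apply spectrum.spectralRadius_lt_of_forall_lt
    intro z hz
    rw [← spectrum.map_inv, Set.mem_inv] at hz
    by_contra hlt
    refine h z⁻¹ ?_ hz
    rw [norm_inv]
    apply inv_le_one_of_one_le₀
    exact_mod_cast not_lt.1 hlt
  have hlim : Tendsto (fun n : ℕ => ((a⁻¹ : (X →L[ℂ] X)ˣ) : X →L[ℂ] X) ^ n) atTop (𝓝 0) := by
    set b := ((a⁻¹ : (X →L[ℂ] X)ˣ) : X →L[ℂ] X)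
    obtain ⟨q, hq1, hq2⟩ := ENNReal.lt_iff_exists_nnreal_btwn.1 hr
    have hq2' : q < 1 := by exact_mod_cast hq2
    have hg := spectrum.pow_nnnorm_pow_one_div_tendsto_nhds_spectralRadius b
    have hev := hg.eventually_lt_const hq1
    rw [tendsto_zero_iff_norm_tendsto_zero]
    refine squeeze_zero' (Eventually.of_forall fun _ => norm_nonneg _) ?_
      (tendsto_pow_atTop_nhds_zero_of_lt_one q.2 (by exact_mod_cast hq2'))
    filter_upwards [hev, eventually_gt_atTop 0] with n hn hn0
    have h1 : (‖b ^ n‖₊ : ENNReal) ≤ (q : ENNReal) ^ n := by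
      have := ENNReal.rpow_le_rpow hn.le (z := n) (by positivity)
      rw [← ENNReal.rpow_mul, one_div, inv_mul_cancel₀ (by positivity), ENNReal.rpow_one,
        ENNReal.rpow_natCast] at this
      exact this
    exact_mod_cast h1
  rw [Set.eq_empty_iff_forall_notMem]
  rintro y ⟨k, hk, u, hu, hT⟩
  have h1 : Tendsto (fun n => (((a⁻¹ : (X →L[ℂ] X)ˣ) : X →L[ℂ] X) ^ k n)
      (((a : X →L[ℂ] X) ^ k n) (u n))) atTop (𝓝 ((0 : X →L[ℂ] X) y)) :=
    (isBoundedBilinearMap_apply (𝕜 := ℂ) (E := X) (F := X)).continuous.continuousAt.tendsto.comp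
      ((hlim.comp hk.tendsto_atTop).prodMk_nhds hT)
  have h2 : Tendsto u atTop (𝓝 0) := by
    refine h1.congr fun n => ?_
    rw [← mul_apply_eq_comp, ← Units.val_pow_eq_pow_val, ← Units.val_pow_eq_pow_val,
      ← Units.val_mul, inv_pow, inv_mul_cancel]
    simp
  exact hx (tendsto_nhds_unique hu h2)

/-- Index zero: a finite rank perturbation is invertible. -/
def IdxZero (A : X →L[ℂ] X) : Prop :=
  ∃ F : X →L[ℂ] X, FiniteDimensional ℂ F.range ∧ IsUnit (A + F)

lemma finrk_add (F G : X →L[ℂ] X) (hF : FiniteDimensional ℂ F.range)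
    (hG : FiniteDimensional ℂ G.range) : FiniteDimensional ℂ (F + G).range := by
  have : (F + G).range ≤ F.range ⊔ G.range := by
    rintro _ ⟨x, rfl⟩
    exact Submodule.add_mem_sup ⟨x, rfl⟩ ⟨x, rfl⟩
  exact Submodule.finiteDimensional_of_le this

lemma finrk_comp (A F : X →L[ℂ] X) (hF : FiniteDimensional ℂ F.range) :
    FiniteDimensional ℂ (A * F).range := by
  have : (A * F).range ≤ F.range.map (A : X →ₗ[ℂ] X) := by
    rintro _ ⟨x, rfl⟩
    exact ⟨F x, ⟨x, rfl⟩, rfl⟩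
  exact Submodule.finiteDimensional_of_le this

lemma finrk_neg (F : X →L[ℂ] X) (hF : FiniteDimensional ℂ F.range) :
    FiniteDimensional ℂ (-F).range := by
  have := finrk_comp (-1) F hF
  rwa [neg_one_mul] at this

lemma IdxZero.add {A : X →L[ℂ] X} (h : IdxZero A) (G : X →L[ℂ] X)
    (hG : FiniteDimensional ℂ G.range) : IdxZero (A + G) := by
  obtain ⟨F, hF, hu⟩ := h
  refine ⟨F + -G, finrk_add _ _ hF (finrk_neg _ hG), ?_⟩
  convert hu using 1
  abel

lemma isOpen_idxZero [CompleteSpace X] : IsOpen {A : X →L[ℂ] X | IdxZero A} := by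
  rw [isOpen_iff_mem_nhds]
  rintro A ⟨F, hF, hu⟩
  have : ∀ᶠ B in 𝓝 A, IsUnit (B + F) :=
    (continuous_id.add continuous_const).continuousAt.eventually
      (Units.isOpen.mem_nhds (x := A + F) hu)
  filter_upwards [this] with B hB
  exact ⟨F, hF, hB⟩

lemma IdxZero.not_unit {A : X →L[ℂ] X} (h : IdxZero A) (hA : ¬ IsUnit A) :
    (∃ x, x ≠ 0 ∧ A x = 0) ∧ ∃ f : X →L[ℂ] ℂ, f ≠ 0 ∧ ∀ x, f (A x) = 0 := by
  obtain ⟨F, hF, B, hB⟩ := h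
  set K : X →L[ℂ] X := (B⁻¹ : (X →L[ℂ] X)ˣ) * F with hK
  have hKfin : FiniteDimensional ℂ K.range := finrk_comp _ _ hF
  have hAB : A = B * (1 - K) := by
    rw [hK, mul_sub, ← mul_assoc, Units.mul_inv, hB]; simp
  let R := K.range
  -- restriction of `1 - K` to `R`
  let K' : X →ₗ[ℂ] R := (K : X →ₗ[ℂ] X).rangeRestrict
  let L : R →ₗ[ℂ] R := LinearMap.id - K' ∘ₗ R.subtype
  have hLval : ∀ r : R, ((L r : R) : X) = r - K r := fun r => rfl
  have hLK : ∀ x, L (K' x) = K' (x - K x) := by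
    intro x
    apply Subtype.ext
    rw [hLval]
    change K x - K (K x) = K (x - K x)
    simp
  have hLinj : ¬ Function.Injective L := by
    intro hinj
    have hsurj := LinearMap.injective_iff_surjective.1 hinj
    apply hA
    obtain ⟨e, he⟩ : ∃ e : R ≃ₗ[ℂ] R, ∀ r, e r = L r :=
      ⟨LinearEquiv.ofBijective L ⟨hinj, hsurj⟩, fun r => rfl⟩
    let M : X →L[ℂ] X := 1 + R.subtypeL.comp
      ((LinearMap.toContinuousLinearMap (e.symm : R →ₗ[ℂ] R)).comp (K.codRestrict R fun x => ⟨x, rfl⟩))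
    have hM : ∀ x, M x = x + (e.symm (K' x) : R) := fun x => rfl
    have h1 : (1 - K) * M = 1 := by
      ext x
      change M x - K (M x) = x
      have h2 := hLval (e.symm (K' x))
      rw [← he, e.apply_symm_apply] at h2
      have h3 : K x = (e.symm (K' x) : R) - K (e.symm (K' x) : R) := h2
      rw [hM, map_add, h3]
      abel
    have h2 : M * (1 - K) = 1 := by
      ext x
      change M (x - K x) = x
      rw [hM, ← hLK, ← he, e.symm_apply_apply]
      change x - K x + K x = x
      abel
    have hu : IsUnit (1 - K) := ⟨⟨1 - K, M, h1, h2⟩, rfl⟩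
    rw [hAB]
    exact B.isUnit.mul hu
  have hLsurj : ¬ Function.Surjective L := fun h => hLinj (LinearMap.injective_iff_surjective.2 h)
  constructor
  · rw [← LinearMap.ker_eq_bot, Submodule.eq_bot_iff] at hLinj
    push Not at hLinj
    obtain ⟨r, hr, hr0⟩ := hLinj
    refine ⟨r, by simpa using hr0, ?_⟩
    have h2 := hLval r
    rw [LinearMap.mem_ker.1 hr] at h2
    rw [hAB]
    change (B : X →L[ℂ] X) ((r : X) - K r) = 0
    rw [← h2]; simp
  · rw [← LinearMap.range_eq_top] at hLsurj
    obtain ⟨g, hg0, hg⟩ := Submodule.exists_dual_map_eq_bot_of_lt_top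
      (lt_top_iff_ne_top.2 hLsurj) inferInstance
    have hgL : ∀ r, g (L r) = 0 := by
      intro r
      have : g (L r) ∈ (LinearMap.range L).map g := ⟨L r, ⟨r, rfl⟩, rfl⟩
      rw [hg] at this
      simpa using this
    let f0 : X →L[ℂ] ℂ := (LinearMap.toContinuousLinearMap g).comp
      (K.codRestrict R fun x => ⟨x, rfl⟩)
    have hf0 : ∀ x, f0 x = g (K' x) := fun x => rfl
    refine ⟨f0.comp ((B⁻¹ : (X →L[ℂ] X)ˣ) : X →L[ℂ] X), ?_, ?_⟩
    · intro h
      apply hg0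
      ext ⟨r, x, hx⟩
      have := DFunLike.congr_fun h ((B : X →L[ℂ] X) x)
      have h4 : ((B⁻¹ : (X →L[ℂ] X)ˣ) : X →L[ℂ] X) ((B : X →L[ℂ] X) x) = x := by
        rw [← mul_apply_eq_comp, Units.inv_mul]; rfl
      rw [ContinuousLinearMap.comp_apply, h4, hf0] at this
      have h5 : (K' x) = ⟨r, x, hx⟩ := Subtype.ext hx
      rw [← h5]; simpa using this
    · intro x
      have h4 : ((B⁻¹ : (X →L[ℂ] X)ˣ) : X →L[ℂ] X) (A x) = x - K x := by
        rw [hAB, ← mul_apply_eq_comp, ← mul_assoc, Units.inv_mul]; simp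
      rw [ContinuousLinearMap.comp_apply, h4, hf0, ← hLK, hgL]

lemma IdxZero.isUnit_of_injective {A : X →L[ℂ] X} (h : IdxZero A) (hA : Function.Injective A) :
    IsUnit A := by
  by_contra hu
  obtain ⟨⟨x, hx, hx'⟩, -⟩ := h.not_unit hu
  exact hx (hA (by rw [hx', map_zero]))

lemma IdxZero.isUnit_of_surjective {A : X →L[ℂ] X} (h : IdxZero A) (hA : Function.Surjective A) :
    IsUnit A := by
  by_contra hu
  obtain ⟨-, f, hf, hvan⟩ := h.not_unit hu
  apply hf
  ext y
  obtain ⟨x, rfl⟩ := hA y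
  simpa using hvan x

/-- A bounded below limit of index zero operators is invertible. -/
lemma isUnit_of_bddBelow [CompleteSpace X] (C : X →L[ℂ] X) (hC : C ∈ closure {A | IdxZero A})
    (c : ℝ) (hc : 0 < c) (hb : ∀ x, c * ‖x‖ ≤ ‖C x‖) : IsUnit C := by
  obtain ⟨B, hB, hd⟩ := Metric.mem_closure_iff.1 hC (c / 2) (by positivity)
  rw [dist_eq_norm] at hd
  have hBb : ∀ x, c / 2 * ‖x‖ ≤ ‖B x‖ := by
    intro x
    have h1 := (C - B).le_opNorm x
    have h2 : ‖C x‖ ≤ ‖(C - B) x‖ + ‖B x‖ := by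
      have : C x = (C - B) x + B x := by simp
      rw [this]; exact norm_add_le _ _
    have h3 := mul_le_mul_of_nonneg_right hd.le (norm_nonneg x)
    linarith [hb x]
  have hinj : Function.Injective B := by
    rw [injective_iff_map_eq_zero]
    intro x hx
    have := hBb x
    rw [hx, norm_zero] at this
    have h0 := norm_nonneg x
    exact norm_eq_zero.1 (by nlinarith)
  obtain ⟨b, rfl⟩ := IdxZero.isUnit_of_injective hB hinj
  set bi : X →L[ℂ] X := ((b⁻¹ : (X →L[ℂ] X)ˣ) : X →L[ℂ] X) with hbi
  have hn : ‖bi‖ ≤ 2 / c := by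
    refine ContinuousLinearMap.opNorm_le_bound _ (by positivity) fun y => ?_
    have h1 := hBb (bi y)
    rw [← mul_apply_eq_comp, hbi, Units.mul_inv] at h1
    change c / 2 * ‖bi y‖ ≤ ‖y‖ at h1
    rw [div_mul_eq_mul_div, le_div_iff₀ hc]
    linarith
  have hu : IsUnit (1 - bi * ((b : X →L[ℂ] X) - C)) := by
    apply isUnit_one_sub_of_norm_lt_one
    rw [norm_sub_rev] at hd
    calc _ ≤ ‖bi‖ * ‖(b : X →L[ℂ] X) - C‖ := norm_mul_le _ _
      _ ≤ 2 / c * ‖(b : X →L[ℂ] X) - C‖ := by gcongr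
      _ < 2 / c * (c / 2) := by gcongr
      _ = 1 := by field_simp
  have : C = b * (1 - bi * ((b : X →L[ℂ] X) - C)) := by
    rw [mul_sub, ← mul_assoc, hbi, Units.mul_inv]; simp
  rw [this]
  exact b.isUnit.mul hu

/-- A limit of index zero operators having a right inverse is invertible. -/
lemma isUnit_of_rightInv [CompleteSpace X] (C : X →L[ℂ] X) (hC : C ∈ closure {A | IdxZero A})
    (R : X →L[ℂ] X) (hR : C * R = 1) : IsUnit C := by
  have hev : ∀ᶠ B in 𝓝 C, IsUnit (B * R) :=
    (continuous_id.mul continuous_const).continuousAt.eventually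
      (Units.isOpen.mem_nhds (x := C * R) (by rw [hR]; exact isUnit_one))
  obtain ⟨B, hB, hu⟩ := ((mem_closure_iff_frequently.1 hC).and_eventually hev).exists
  have hsurj : Function.Surjective B := by
    obtain ⟨v, hv⟩ := hu
    intro y
    refine ⟨R (((v⁻¹ : (X →L[ℂ] X)ˣ) : X →L[ℂ] X) y), ?_⟩
    rw [← mul_apply_eq_comp, ← hv, ← mul_apply_eq_comp, Units.mul_inv]
    rfl
  obtain ⟨b, rfl⟩ := IdxZero.isUnit_of_surjective hB hsurj
  have hRu : IsUnit R := by
    have : R = ((b⁻¹ : (X →L[ℂ] X)ˣ) : X →L[ℂ] X) * (b * R) := by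
      rw [← mul_assoc, Units.inv_mul, one_mul]
    rw [this]
    exact (b⁻¹).isUnit.mul hu
  obtain ⟨r, rfl⟩ := hRu
  have : C = ((r⁻¹ : (X →L[ℂ] X)ˣ) : X →L[ℂ] X) := by
    rw [← mul_one C, ← Units.mul_inv r, ← mul_assoc, hR, one_mul]
  rw [this]
  exact (r⁻¹).isUnit

lemma exists_inj_or_surj.{u} {V W : Type u} [AddCommGroup V] [Module ℂ V] [AddCommGroup W] [Module ℂ W] :
    ∃ g : V →ₗ[ℂ] W, Function.Injective g ∨ Function.Surjective g := by
  rcases le_total (Module.rank ℂ V) (Module.rank ℂ W) with h | h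
  · obtain ⟨g, hg⟩ := rank_le_iff_exists_linearMap.1 h
    exact ⟨g, Or.inl hg⟩
  · obtain ⟨g, hg⟩ := rank_le_iff_exists_linearMap.1 h
    obtain ⟨k, hk⟩ := g.exists_leftInverse_of_injective (LinearMap.ker_eq_bot.2 hg)
    exact ⟨k, Or.inr fun w => ⟨g w, LinearMap.congr_fun hk w⟩⟩

lemma exists_rightInv [CompleteSpace X] (C : X →L[ℂ] X) (hs : Function.Surjective C)
    (hk : FiniteDimensional ℂ C.ker) : ∃ R : X →L[ℂ] X, C * R = 1 := by
  obtain ⟨p, hp⟩ := Submodule.ClosedComplemented.of_finiteDimensional C.ker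
  let Z : Submodule ℂ X := p.ker
  have hZ : IsClosed (Z : Set X) := p.isClosed_ker
  have : CompleteSpace Z := hZ.completeSpace_coe
  let D : Z →L[ℂ] X := C.comp Z.subtypeL
  have hD : ∀ z : Z, D z = C z := fun z => rfl
  have hinj : D.ker = ⊥ := by
    rw [Submodule.eq_bot_iff]
    intro z hz
    have h1 : (z : X) ∈ C.ker := hz
    have h2 := hp ⟨z, h1⟩
    have h3 : p z = 0 := z.2
    rw [h3] at h2
    exact Subtype.ext (congrArg Subtype.val h2).symm
  have hsurj : D.range = ⊤ := by
    rw [eq_top_iff]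
    rintro y -
    obtain ⟨x, rfl⟩ := hs y
    have h0 : C (p x : X) = 0 := (p x).2
    refine ⟨⟨x - p x, ?_⟩, ?_⟩
    · change p (x - p x) = 0
      rw [map_sub, hp, sub_self]
    · change C (x - p x) = C x
      rw [map_sub, h0, sub_zero]
  let e := ContinuousLinearEquiv.ofBijective D hinj hsurj
  refine ⟨Z.subtypeL.comp (e.symm : X →L[ℂ] Z), ?_⟩
  ext y
  exact ContinuousLinearEquiv.ofBijective_apply_symm_apply D hinj hsurj y

/-- A semi-Fredholm limit of index zero operators has index zero. -/
lemma idxZero_of_closure [CompleteSpace X] (A : X →L[ℂ] X) (hA : A ∈ closure {A | IdxZero A})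
    (Q : X →L[ℂ] X) (hQ : FiniteDimensional ℂ Q.range) (hQQ : ∀ x, Q (Q x) = Q x)
    (c : ℝ) (hc : 0 < c) (hb : ∀ x, Q x = 0 → c * ‖x‖ ≤ ‖A x‖) : IdxZero A := by
  let W : Submodule ℂ X := Q.ker
  have hW : IsClosed (W : Set X) := Q.isClosed_ker
  have : CompleteSpace W := hW.completeSpace_coe
  let D : W →L[ℂ] X := A.comp W.subtypeL
  have hDc : IsClosed (D.range : Set X) := by
    have : AntilipschitzWith (Real.toNNReal c⁻¹) D := by
      refine AddMonoidHomClass.antilipschitz_of_bound D fun x => ?_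
      rw [Real.coe_toNNReal _ (by positivity), inv_mul_eq_div, le_div_iff₀ hc, mul_comm]
      exact hb x x.2
    exact this.isClosed_range D.uniformContinuous
  let V : Submodule ℂ X := D.range
  obtain ⟨g0, hg0⟩ := exists_inj_or_surj (V := Q.range) (W := X ⧸ V)
  obtain ⟨s, hs⟩ := V.mkQ.exists_rightInverse_of_surjective V.range_mkQ
  let G : Q.range →L[ℂ] X := LinearMap.toContinuousLinearMap (s ∘ₗ g0)
  have hG : ∀ q, V.mkQ (G q) = g0 q := fun q => LinearMap.congr_fun hs (g0 q)
  let Q' : X →L[ℂ] Q.range := Q.codRestrict Q.range fun x => ⟨x, rfl⟩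
  have hQ' : ∀ x, ((Q' x : Q.range) : X) = Q x := fun x => rfl
  let F : X →L[ℂ] X := G.comp Q' - A * Q
  have hF : FiniteDimensional ℂ F.range := by
    have h1 : FiniteDimensional ℂ (G.comp Q').range := by
      have : (G.comp Q').range ≤ (G : Q.range →ₗ[ℂ] X).range := by
        rintro _ ⟨x, rfl⟩
        exact ⟨Q' x, rfl⟩
      exact Submodule.finiteDimensional_of_le this
    have := finrk_add _ _ h1 (finrk_neg _ (finrk_comp A Q hQ))
    rwa [← sub_eq_add_neg] at this
  have hCx : ∀ x, (A + F) x = A (x - Q x) + G (Q' x) := by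
    intro x
    change A x + (G (Q' x) - A (Q x)) = _
    rw [map_sub]; abel
  have hmem : ∀ x, A (x - Q x) ∈ V := by
    intro x
    exact ⟨⟨x - Q x, by change Q (x - Q x) = 0; rw [map_sub, hQQ, sub_self]⟩, rfl⟩
  have hmk : ∀ x, V.mkQ ((A + F) x) = g0 (Q' x) := by
    intro x
    rw [hCx, map_add, hG]
    have : V.mkQ (A (x - Q x)) = 0 := by
      rw [← LinearMap.mem_ker, V.ker_mkQ]; exact hmem x
    rw [this, zero_add]
  have hcl : A + F ∈ closure {A | IdxZero A} := by
    have : Set.MapsTo (fun B : X →L[ℂ] X => B + F) {A | IdxZero A} {A | IdxZero A} :=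
      fun B hB => IdxZero.add hB F hF
    exact map_mem_closure (f := fun B : X →L[ℂ] X => B + F) (by fun_prop) hA this
  -- elements of `W` killed by `A`
  have hker : ∀ x, Q' x = 0 → (A + F) x = 0 → x = 0 := by
    intro x hx h
    have hq : Q x = 0 := by rw [← hQ', hx]; rfl
    rw [hCx, hx, hq, sub_zero, map_zero, add_zero] at h
    have h1 := hb x hq
    rw [h, norm_zero] at h1
    have h0 := norm_nonneg x
    exact norm_eq_zero.1 (by nlinarith)
  refine ⟨F, hF, ?_⟩
  rcases hg0 with hg0 | hg0
  · have hinj : Function.Injective (A + F) := by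
      rw [injective_iff_map_eq_zero]
      intro x hx
      refine hker x (hg0 ?_) hx
      rw [← hmk, hx, map_zero, map_zero]
    have hrange : (A + F).range = V ⊔ (G : Q.range →ₗ[ℂ] X).range := by
      apply le_antisymm
      · rintro _ ⟨x, rfl⟩
        change (A + F) x ∈ _
        rw [hCx]
        exact Submodule.add_mem_sup (hmem x) ⟨Q' x, rfl⟩
      · apply sup_le
        · rintro _ ⟨⟨w, hw⟩, rfl⟩
          have hw' : Q w = 0 := hw
          refine ⟨w, ?_⟩
          change (A + F) w = A w
          have : Q' w = 0 := Subtype.ext hw'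
          rw [hCx, hw', this]; simp
        · rintro _ ⟨⟨_, x, rfl⟩, rfl⟩
          refine ⟨Q x, ?_⟩
          change (A + F) (Q x) = _
          rw [hCx, hQQ, sub_self, map_zero, zero_add]
          have : Q' (Q x) = Q' x := Subtype.ext (hQQ x)
          rw [this]; rfl
    have hclosed : IsClosed (Set.range (A + F)) := by
      have h1 := Submodule.isClosed_sup_finiteDimensional V (G : Q.range →ₗ[ℂ] X).range hDc
      rw [← hrange] at h1
      exact h1
    obtain ⟨K, hK⟩ := (A + F).antilipschitz_of_injective_of_isClosed_range hinj hclosed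
    refine isUnit_of_bddBelow _ hcl ((K : ℝ) + 1)⁻¹ (by positivity) fun x => ?_
    have h1 := hK.le_mul_norm (map_zero _) x
    rw [inv_mul_le_iff₀ (by positivity)]
    nlinarith [norm_nonneg ((A + F) x)]
  · have hsurj : Function.Surjective (A + F) := by
      intro y
      obtain ⟨q, hq⟩ := hg0 (V.mkQ y)
      obtain ⟨⟨_, x, rfl⟩, hx⟩ : ∃ q' : Q.range, q' = q := ⟨q, rfl⟩
      have hqq : Q' (Q x) = q := by rw [← hx]; exact Subtype.ext (hQQ x)
      have h1 : y - (A + F) (Q x) ∈ V := by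
        rw [← V.ker_mkQ, LinearMap.mem_ker, map_sub, hmk, hqq, hq, sub_self]
      obtain ⟨⟨w, hw⟩, hw2⟩ := h1
      have hw' : Q w = 0 := hw
      have hw3 : A w = y - (A + F) (Q x) := hw2
      refine ⟨w + Q x, ?_⟩
      have : Q' w = 0 := Subtype.ext hw'
      have h4 : (A + F) w = A w := by rw [hCx, hw', this]; simp
      rw [map_add, h4, hw3]; abel
    have hkf : FiniteDimensional ℂ (A + F).ker := by
      refine FiniteDimensional.of_injective
        ((Q' : X →ₗ[ℂ] Q.range) ∘ₗ (A + F).ker.subtype) ?_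
      rw [← LinearMap.ker_eq_bot, Submodule.eq_bot_iff]
      rintro ⟨x, hx⟩ h
      exact Subtype.ext (hker x h hx)
    obtain ⟨R, hR⟩ := exists_rightInv _ hsurj hkf
    exact isUnit_of_rightInv _ hcl R hR

/-- If `A` is bounded below on no closed finite codimensional subspace, it is small on some
infinite dimensional subspace. -/
lemma exists_proj_of_no_small (A : X →L[ℂ] X) (ε : ℝ) (hε : 0 < ε)
    (h : ∀ M : Submodule ℂ X, (∀ x ∈ M, ‖A x‖ ≤ ε * ‖x‖) → FiniteDimensional ℂ M) :
    ∃ Q : X →L[ℂ] X, FiniteDimensional ℂ Q.range ∧ (∀ x, Q (Q x) = Q x) ∧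
      ∃ c : ℝ, 0 < c ∧ ∀ x, Q x = 0 → c * ‖x‖ ≤ ‖A x‖ := by
  by_contra! H
  -- sequences (vector, functional, bound)
  obtain ⟨z, hzP, hzr⟩ := exists_seq_of_forall_finset_exists
    (fun z : X × (X →L[ℂ] ℂ) × ℝ => ‖z.1‖ = 1 ∧ z.2.1 z.1 = 1 ∧ ‖z.2.1‖ ≤ 1 ∧
      0 < z.2.2 ∧ z.2.2 ≤ ε / 4 ∧ ‖A z.1‖ ≤ z.2.2)
    (fun z y => z.2.1 y.1 = 0 ∧ y.2.2 ≤ z.2.2 / 4) (by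
      intro s hs
      let Φ : X →L[ℂ] (s → ℂ) := ContinuousLinearMap.pi fun i => i.1.2.1
      have hΦ : ∀ x i, Φ x i = i.1.2.1 x := fun x i => rfl
      obtain ⟨p, hp⟩ := Φ.ker_closedComplemented_of_finiteDimensional_range
      let Q : X →L[ℂ] X := 1 - Φ.ker.subtypeL.comp p
      have hQ : ∀ x, Q x = x - p x := fun x => rfl
      have hQp : ∀ x, Q (p x : X) = 0 := fun x => by rw [hQ, hp, sub_self]
      have hQQ : ∀ x, Q (Q x) = Q x := fun x => by
        conv_lhs => rw [hQ x, map_sub, hQp, sub_zero]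
      have hQ0 : ∀ x, Φ x = 0 → Q x = 0 := fun x hx => by
        have := hp ⟨x, hx⟩
        rw [hQ, this, sub_self]
      have hfin : FiniteDimensional ℂ Q.range := by
        refine FiniteDimensional.of_injective ((Φ : X →ₗ[ℂ] (s → ℂ)) ∘ₗ Q.range.subtype) ?_
        rw [← LinearMap.ker_eq_bot, Submodule.eq_bot_iff]
        rintro ⟨_, x, rfl⟩ hx
        have h1 := hQ0 (Q x) hx
        rw [hQQ] at h1
        exact Subtype.ext h1
      obtain ⟨δ, hδ0, hδε, hδs⟩ : ∃ δ : ℝ, 0 < δ ∧ δ ≤ ε / 4 ∧ ∀ z ∈ s, δ ≤ z.2.2 / 4 := by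
        have h1 : ∀ᶠ δ in 𝓝[>] (0 : ℝ), ∀ z ∈ s, δ ≤ z.2.2 / 4 := by
          rw [Filter.eventually_all_finset]
          intro z hz
          have : (0 : ℝ) < z.2.2 / 4 := by linarith [(hs z hz).2.2.2.1]
          exact (eventually_le_nhds this).filter_mono nhdsWithin_le_nhds
        have h2 : ∀ᶠ δ in 𝓝[>] (0 : ℝ), δ ≤ ε / 4 :=
          (eventually_le_nhds (by positivity)).filter_mono nhdsWithin_le_nhds
        have h3 : ∀ᶠ δ in 𝓝[>] (0 : ℝ), 0 < δ := self_mem_nhdsWithin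
        obtain ⟨δ, h⟩ := (h3.and (h2.and h1)).exists
        exact ⟨δ, h⟩
      obtain ⟨x, hx, hxA⟩ := H Q hfin hQQ δ hδ0
      have hx0 : 0 < ‖x‖ := by
        by_contra hn
        have : ‖x‖ = 0 := le_antisymm (not_lt.1 hn) (norm_nonneg _)
        rw [this, mul_zero] at hxA
        exact absurd hxA (not_lt.2 (norm_nonneg _))
      set y : X := ((‖x‖⁻¹ : ℝ) : ℂ) • x with hy
      have hy1 : ‖y‖ = 1 := by
        rw [hy, norm_smul, Complex.norm_real, norm_inv, norm_norm, inv_mul_cancel₀ hx0.ne']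
      obtain ⟨f, hf1, hf2⟩ := exists_dual_vector'' ℂ y
      have hΦx : Φ x = 0 := by
        rw [hQ, sub_eq_zero] at hx
        rw [hx]; exact (p x).2
      refine ⟨(y, f, δ), ⟨hy1, ?_, hf1, hδ0, hδε, ?_⟩, ?_⟩
      · change f y = 1
        rw [hf2, hy1]; simp
      · change ‖A y‖ ≤ δ
        rw [hy, map_smul, norm_smul, Complex.norm_real, norm_inv, norm_norm,
          inv_mul_le_iff₀ hx0]
        linarith
      · intro z hz
        refine ⟨?_, hδs z hz⟩
        change z.2.1 y = 0
        have := congrFun hΦx ⟨z, hz⟩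
        rw [hΦ] at this
        rw [hy, map_smul]
        have h3 : z.2.1 x = 0 := this
        rw [h3, smul_zero])
  let x : ℕ → X := fun n => (z n).1
  let f : ℕ → X →L[ℂ] ℂ := fun n => (z n).2.1
  let δ : ℕ → ℝ := fun n => (z n).2.2
  have hx1 : ∀ n, ‖x n‖ = 1 := fun n => (hzP n).1
  have hfx : ∀ n, f n (x n) = 1 := fun n => (hzP n).2.1
  have hf1 : ∀ n, ‖f n‖ ≤ 1 := fun n => (hzP n).2.2.1
  have hδA : ∀ n, ‖A (x n)‖ ≤ δ n := fun n => (hzP n).2.2.2.2.2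
  have hfo : ∀ m n, m < n → f m (x n) = 0 := fun m n hmn => (hzr m n hmn).1
  have hδ : ∀ n, δ n ≤ ε / 4 * (1 / 4) ^ n := by
    intro n
    induction n with
    | zero => simpa using (hzP 0).2.2.2.2.1
    | succ n ih =>
      have h1 : δ (n + 1) ≤ δ n / 4 := (hzr n (n + 1) (Nat.lt_succ_self n)).2
      rw [pow_succ]; linarith
  have hcoef : ∀ (l : ℕ → ℂ) (N n : ℕ), n < N →
      ‖l n‖ ≤ 2 ^ n * ‖∑ i ∈ Finset.range N, l i • x i‖ := by
    intro l N n
    induction n using Nat.strong_induction_on with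
    | _ n ih =>
      intro hn
      set v := ∑ i ∈ Finset.range N, l i • x i with hv
      have h1 : f n v = ∑ i ∈ Finset.range (n + 1), l i * f n (x i) := by
        rw [hv, map_sum]
        simp only [map_smul, smul_eq_mul]
        symm
        apply Finset.sum_subset
        · intro i hi
          simp only [Finset.mem_range] at hi ⊢
          omega
        · intro i _ hi
          simp only [Finset.mem_range, not_lt] at hi
          rw [hfo n i (by omega), mul_zero]
      rw [Finset.sum_range_succ, hfx, mul_one] at h1
      have h2 : l n = f n v - ∑ i ∈ Finset.range n, l i * f n (x i) := by rw [h1]; ring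
      have hfb : ∀ u, ‖f n u‖ ≤ ‖u‖ := fun u => by
        have := (f n).le_of_opNorm_le (hf1 n) u
        simpa using this
      have h3 : ‖∑ i ∈ Finset.range n, l i * f n (x i)‖ ≤
          ∑ i ∈ Finset.range n, 2 ^ i * ‖v‖ := by
        refine norm_sum_le_of_le _ fun i hi => ?_
        have hi' := Finset.mem_range.1 hi
        rw [norm_mul]
        have h4 := ih i hi' (by omega)
        have h5 := hfb (x i)
        rw [hx1] at h5
        calc ‖l i‖ * ‖f n (x i)‖ ≤ ‖l i‖ * 1 := by gcongr
          _ ≤ _ := by rw [mul_one]; exact h4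
      rw [← Finset.sum_mul] at h3
      have h6 : ∑ i ∈ Finset.range n, (2 : ℝ) ^ i = 2 ^ n - 1 := by
        rw [geom_sum_eq (by norm_num)]; norm_num
      rw [h6] at h3
      calc ‖l n‖ ≤ ‖f n v‖ + ‖∑ i ∈ Finset.range n, l i * f n (x i)‖ := by
            conv_lhs => rw [h2]
            exact norm_sub_le _ _
        _ ≤ ‖v‖ + (2 ^ n - 1) * ‖v‖ := add_le_add (hfb v) h3
        _ = _ := by ring
  have hlin : LinearIndependent ℂ x := by
    rw [linearIndependent_iff']
    intro s g hg i hi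
    obtain ⟨N, hN⟩ := s.exists_nat_subset_range
    classical
    let l : ℕ → ℂ := fun i => if i ∈ s then g i else 0
    have h1 : ∑ i ∈ Finset.range N, l i • x i = 0 := by
      rw [← hg]
      symm
      have : ∑ i ∈ s, g i • x i = ∑ i ∈ s, l i • x i :=
        Finset.sum_congr rfl fun i hi => by simp [l, hi]
      rw [this]
      exact Finset.sum_subset hN fun i _ hi => by simp [l, hi]
    have h2 := hcoef l N i (Finset.mem_range.1 (hN hi))
    rw [h1, norm_zero, mul_zero] at h2
    have h3 : l i = 0 := norm_eq_zero.1 (le_antisymm h2 (norm_nonneg _))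
    simpa [l, hi] using h3
  have hM : FiniteDimensional ℂ (Submodule.span ℂ (Set.range x)) := by
    apply h
    intro v hv
    obtain ⟨l, rfl⟩ := Finsupp.mem_span_range_iff_exists_finsupp.1 hv
    obtain ⟨N, hN⟩ := l.support.exists_nat_subset_range
    have h1 : (l.sum fun i a => a • x i) = ∑ i ∈ Finset.range N, l i • x i :=
      Finset.sum_subset hN fun i _ hi => by
        rw [Finsupp.notMem_support_iff.1 hi]; exact zero_smul _ _
    rw [h1]
    set v := ∑ i ∈ Finset.range N, l i • x i with hv
    have h2 : ‖A v‖ ≤ ∑ i ∈ Finset.range N, (1 / 2) ^ i * (ε / 4 * ‖v‖) := by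
      rw [hv, map_sum]
      refine norm_sum_le_of_le _ fun i hi => ?_
      rw [map_smul, norm_smul]
      have h3 := hcoef l N i (Finset.mem_range.1 hi)
      rw [← hv] at h3 ⊢
      calc ‖l i‖ * ‖A (x i)‖ ≤ (2 ^ i * ‖v‖) * (ε / 4 * (1 / 4) ^ i) := by
            gcongr
            exact (hδA i).trans (hδ i)
        _ = (2 * (1 / 4)) ^ i * (ε / 4 * ‖v‖) := by rw [mul_pow]; ring
        _ = _ := by norm_num
    rw [← Finset.sum_mul] at h2
    have h4 : ∑ i ∈ Finset.range N, (1 / 2 : ℝ) ^ i ≤ 2 := by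
      rw [geom_sum_eq (by norm_num)]
      have : (0 : ℝ) ≤ (1 / 2) ^ N := by positivity
      have h5 : ((1 / 2 : ℝ) ^ N - 1) / (1 / 2 - 1) = 2 - 2 * (1 / 2) ^ N := by ring
      rw [h5]; linarith
    have h5 : 0 ≤ ε / 4 * ‖v‖ := by positivity
    have h6 := mul_le_mul_of_nonneg_right h4 h5
    linarith
  have h1 := linearIndependent_span hlin
  have h2 : Finite ℕ := h1.finite_of_isNoetherian
  exact not_finite ℕ

lemma idxZero_smul_add [CompleteSpace X] (S : X →L[ℂ] X) (hS : StrictlySingular S) (μ : ℂ)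
    (hμ : μ ≠ 0) : IdxZero (μ • (1 : X →L[ℂ] X) + S) := by
  let Γ : ℝ → (X →L[ℂ] X) := fun t => μ • (1 : X →L[ℂ] X) + (t : ℂ) • S
  have hΓ : Continuous Γ := by fun_prop
  have hμ' : 0 < ‖μ‖ := norm_pos_iff.2 hμ
  have hclopen : IsClopen (Γ ⁻¹' {A | IdxZero A}) := by
    refine ⟨?_, isOpen_idxZero.preimage hΓ⟩
    rw [← closure_subset_iff_isClosed]
    intro t ht
    have hcl : Γ t ∈ closure {A | IdxZero A} := hΓ.closure_preimage_subset _ ht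
    obtain ⟨Q, hQ, hQQ, c, hc, hb⟩ := exists_proj_of_no_small (Γ t) (‖μ‖ / 2) (by positivity) (by
      intro M hM
      by_contra hfin
      refine hS M hfin ⟨‖μ‖ / (2 * (|t| + 1)), by positivity, fun x hx => ?_⟩
      have h1 := hM x hx
      have h2 : μ • x = Γ t x - (t : ℂ) • S x := by simp [Γ]
      have h3 : ‖μ‖ * ‖x‖ ≤ ‖Γ t x‖ + |t| * ‖S x‖ := by
        rw [← norm_smul, h2]
        refine (norm_sub_le _ _).trans ?_
        rw [norm_smul, Complex.norm_real, Real.norm_eq_abs]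
      rw [div_mul_eq_mul_div, div_le_iff₀ (by positivity)]
      nlinarith [norm_nonneg (S x)])
    exact idxZero_of_closure _ hcl Q hQ hQQ c hc hb
  have huniv := hclopen.eq_univ ⟨0, by
    refine ⟨0, ?_, ?_⟩
    · rw [show ((0 : X →L[ℂ] X) : X →ₗ[ℂ] X) = 0 from rfl, LinearMap.range_zero]
      infer_instance
    · simp only [Γ, Complex.ofReal_zero, zero_smul, add_zero]
      exact isUnit_one.smul (Units.mk0 μ hμ)⟩
  have : (1 : ℝ) ∈ Γ ⁻¹' {A | IdxZero A} := by rw [huniv]; trivial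
  simpa [Γ] using this


end helpers

theorem stmt_3 {X : Type*} [NormedAddCommGroup X] [NormedSpace ℂ X] [CompleteSpace X]
    (hX : ¬ TopologicalSpace.SeparableSpace X)
    (hform : ∀ T : X →L[ℂ] X, ∃ (w : ℂ) (S : X →L[ℂ] X),
      StrictlySingular S ∧ TopologicalSpace.IsSeparable (Set.range S) ∧
      T = w • ContinuousLinearMap.id ℂ X + S) :
    ∀ (T : X →L[ℂ] X) (x : X), x ≠ 0 → interior (JSet T x) = ∅ := by
  intro T x hx
  have hnt : Nontrivial X := ⟨x, 0, hx⟩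
  obtain ⟨w, S, hS, hsep, hT⟩ := hform T
  have hTv : ∀ v, T v = w • v + S v := fun v => by rw [hT]; rfl
  by_cases hw : ‖w‖ ≤ 1
  · -- a functional vanishing on the range of `S`
    let Y : Submodule ℂ X := S.range.topologicalClosure
    have hYs : TopologicalSpace.IsSeparable (Y : Set X) := hsep.closure
    have hYne : Y ≠ ⊤ := by
      intro h
      rw [h] at hYs
      exact hX (TopologicalSpace.isSeparable_univ_iff.1 hYs)
    obtain ⟨f, hf, hfY⟩ := exists_functional_vanishing Y S.range.isClosed_topologicalClosure hYne
    refine jset_empty_of_eigenfunctional T x f hf w hw fun v => ?_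
    have : f (S v) = 0 := hfY _ (S.range.le_topologicalClosure ⟨v, rfl⟩)
    rw [hTv, map_add, this, add_zero, map_smul, smul_eq_mul]
  by_cases hl : ∀ l : ℂ, ‖l‖ ≤ 1 → l ∉ spectrum ℂ T
  · rw [jset_empty_of_expanding T x hx hl, interior_empty]
  push Not at hl
  obtain ⟨l, hl1, hls⟩ := hl
  have hwl : l - w ≠ 0 := by
    intro h
    rw [sub_eq_zero] at h
    exact hw (h ▸ hl1)
  have hidx := idxZero_smul_add S hS (w - l) (by rw [← neg_sub]; exact neg_ne_zero.2 hwl)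
  have heq : (w - l) • (1 : X →L[ℂ] X) + S = -(algebraMap ℂ (X →L[ℂ] X) l - T) := by
    ext v
    simp [Algebra.algebraMap_eq_smul_one, hTv, sub_smul]
    abel
  rw [heq] at hidx
  obtain ⟨-, f, hf, hfA⟩ := hidx.not_unit (by rw [IsUnit.neg_iff]; exact hls)
  refine jset_empty_of_eigenfunctional T x f hf l hl1 fun v => ?_
  have h1 := hfA v
  have h2 : (-(algebraMap ℂ (X →L[ℂ] X) l - T)) v = T v - l • v := by
    simp [Algebra.algebraMap_eq_smul_one]
  rw [h2, map_sub, map_smul, smul_eq_mul, sub_eq_zero] at h1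
  exact h1
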